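/- Internal enabling in adapted CP-subnets: let (N,μ₀) be a perpetual free-choice system with regeneration cluster cl, let N̂ ⊆ N be a cl-adapted CP-subnet with way-in transition t_in, let μ be a reachable marking of (N,μ₀), and set μ̂ = μ restricted to the places of N̂. Then every transition t of N̂ admitting a path (p,…,t) inside N̂ starting at a place p of N̂ with μ̂(p) = 1 can be enabled by firing an occurrence sequence σ of the Petri net (N̂,μ̂) with t_in ∉ σ. -/

import Mathlib

open Classical

/-- A (finite, bipartite) Petri *net*: disjoint finite sets of places and
transitions, and an edge relation running only between places and transitions. -/
structure Net (α : Type*) where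
  places : Finset α
  transitions : Finset α
  F : α → α → Prop
  disj : Disjoint places transitions
  edges : ∀ x y, F x y →
    (x ∈ places ∧ y ∈ transitions) ∨ (x ∈ transitions ∧ y ∈ places)

namespace Net

variable {α : Type*} [DecidableEq α]

/-- The nodes of a net. -/
def nodes (N : Net α) : Finset α := N.places ∪ N.transitions

/-- Pre-set of a node. -/
def pre (N : Net α) (x : α) : Set α := {y | N.F y x}

/-- Post-set of a node. -/
def post (N : Net α) (x : α) : Set α := {y | N.F x y}

/-- A transition `t` is enabled at a marking `μ` if every pre-place is marked. -/
def Enabled (N : Net α) (μ : α → ℕ) (t : α) : Prop :=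
  t ∈ N.transitions ∧ ∀ p, N.F p t → 1 ≤ μ p

/-- Firing a transition: remove one token from each pre-place,
add one token at each post-place. -/
noncomputable def fire (N : Net α) (t : α) (μ : α → ℕ) : α → ℕ :=
  fun p => μ p - (if N.F p t then 1 else 0) + (if N.F t p then 1 else 0)

/-- `FireSeq N μ σ ν`: the occurrence sequence `σ` is enabled at `μ` and
firing it successively leads from `μ` to `ν`. -/
inductive FireSeq (N : Net α) : (α → ℕ) → List α → (α → ℕ) → Prop
  | nil (μ : α → ℕ) : FireSeq N μ [] μ
  | cons {μ ν : α → ℕ} {t : α} {σ : List α} :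
      N.Enabled μ t → FireSeq N (N.fire t μ) σ ν → FireSeq N μ (t :: σ) ν

/-- Reachability of markings. -/
def Reach (N : Net α) (μ ν : α → ℕ) : Prop := ∃ σ : List α, N.FireSeq μ σ ν

/-- The set of transitions enabled at `μ`. -/
def en (N : Net α) (μ : α → ℕ) : Set α := {t | N.Enabled μ t}

/-- Equality of markings (as maps on the places of the net). -/
def MarkingEq (N : Net α) (μ ν : α → ℕ) : Prop := ∀ p ∈ N.places, μ p = ν p

/-- Liveness of a Petri net `(N, μ₀)`. -/
def Live (N : Net α) (μ₀ : α → ℕ) : Prop :=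
  ∀ t ∈ N.transitions, ∀ μ, N.Reach μ₀ μ → ∃ ν, N.Reach μ ν ∧ N.Enabled ν t

/-- Boundedness of a Petri net `(N, μ₀)`. -/
def Bounded (N : Net α) (μ₀ : α → ℕ) : Prop :=
  ∃ K : ℕ, ∀ μ, N.Reach μ₀ μ → ∀ p ∈ N.places, μ p ≤ K

/-- A net is well-formed if it carries a live and bounded marking. -/
def WellFormed (N : Net α) : Prop := ∃ μ₀ : α → ℕ, N.Live μ₀ ∧ N.Bounded μ₀

/-- Free-choice net: `(p,t) ∈ F` implies `•t × p• ⊆ F`. -/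
def FreeChoice (N : Net α) : Prop :=
  ∀ p ∈ N.places, ∀ t, N.F p t → ∀ p', N.F p' t → ∀ t', N.F p t' → N.F p' t'

/-- T-net: every place has exactly one pre-transition and one post-transition. -/
def IsTNet (N : Net α) : Prop :=
  ∀ p ∈ N.places, (∃! t, N.F t p) ∧ (∃! t, N.F p t)

/-- A set of nodes is cluster-closed if with each place it contains the
post-set of the place and with each transition the pre-set of the transition. -/
def ClusterClosed (N : Net α) (S : Set α) : Prop :=
  (∀ p ∈ S, p ∈ N.places → ∀ t, N.F p t → t ∈ S) ∧
  (∀ t ∈ S, t ∈ N.transitions → ∀ p, N.F p t → p ∈ S)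

/-- The cluster of a node: the smallest cluster-closed set of nodes containing it. -/
def clusterOf (N : Net α) (x : α) : Set α :=
  ⋂₀ {S : Set α | x ∈ S ∧ N.ClusterClosed S}

/-- `cl` is a cluster of `N` if it is the cluster of some node. -/
def IsCluster (N : Net α) (cl : Set α) : Prop :=
  ∃ x ∈ N.nodes, cl = N.clusterOf x

/-- The marking `μ_cl` marking exactly the places of the cluster `cl`, once. -/
noncomputable def clusterMarking (N : Net α) (cl : Set α) : α → ℕ :=
  fun p => if p ∈ cl ∧ p ∈ N.places then 1 else 0

/-- `μh` is a home marking of `(N, μ₀)`: reachable from every reachable marking. -/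
def IsHomeMarking (N : Net α) (μ₀ μh : α → ℕ) : Prop :=
  ∀ μ, N.Reach μ₀ μ → ∃ ν, N.Reach μ ν ∧ N.MarkingEq ν μh

/-- `(N, μ₀)` is perpetual with regeneration cluster `cl`: live, bounded, and
`μ_cl` is a home marking for the cluster `cl`. -/
def Perpetual (N : Net α) (μ₀ : α → ℕ) (cl : Set α) : Prop :=
  N.Live μ₀ ∧ N.Bounded μ₀ ∧ N.IsCluster cl ∧
    N.IsHomeMarking μ₀ (N.clusterMarking cl)

/-- Lucency: enabling-equivalent reachable markings are equal. -/
def Lucent (N : Net α) (μ₀ : α → ℕ) : Prop :=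
  ∀ μ₁ μ₂, N.Reach μ₀ μ₁ → N.Reach μ₀ μ₂ → N.en μ₁ = N.en μ₂ → N.MarkingEq μ₁ μ₂

/-- A path of the net: a nonempty sequence of nodes along edges. -/
def IsPath (N : Net α) (δ : List α) : Prop :=
  δ ≠ [] ∧ (∀ x ∈ δ, x ∈ N.nodes) ∧ δ.Chain' N.F

/-- A circuit: a path whose last node is connected back to its first node. -/
def IsCircuit (N : Net α) (δ : List α) : Prop :=
  N.IsPath δ ∧ ∃ h : δ ≠ [], N.F (δ.getLast h) (δ.head h)

/-- Token count of a set of nodes: total number of tokens on its places. -/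
def tokenCount (N : Net α) (μ : α → ℕ) (X : Finset α) : ℕ :=
  ∑ p ∈ X ∩ N.places, μ p

/-- The set `S` of nodes is strongly connected (in the induced subnet). -/
def StronglyConnectedOn (N : Net α) (S : Finset α) : Prop :=
  ∀ x ∈ S, ∀ y ∈ S,
    Relation.ReflTransGen (fun a b => a ∈ S ∧ b ∈ S ∧ N.F a b) x y

/-- The set `S` of nodes is weakly connected (in the induced subnet). -/
def WeaklyConnectedOn (N : Net α) (S : Finset α) : Prop :=
  ∀ x ∈ S, ∀ y ∈ S,
    Relation.ReflTransGen (fun a b => a ∈ S ∧ b ∈ S ∧ (N.F a b ∨ N.F b a)) x y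

/-- The (full) subnet spanned by `S` is transition-bordered: every place of `S`
has all its neighbours inside `S`. -/
def TransitionBordered (N : Net α) (S : Finset α) : Prop :=
  ∀ p ∈ S, p ∈ N.places → ∀ y, (N.F y p ∨ N.F p y) → y ∈ S

/-- The full subnet spanned by `S` is a T-net: each place of `S` has exactly one
pre-transition and one post-transition inside `S`. -/
def TNetOn (N : Net α) (S : Finset α) : Prop :=
  ∀ p ∈ S, p ∈ N.places →
    (∃! t, t ∈ S ∧ N.F t p) ∧ (∃! t, t ∈ S ∧ N.F p t)

/-- `S` spans a CP-subnet of `N`: nonempty, weakly connected, transition-bordered,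
a T-net, and the complement contains a transition and is strongly connected. -/
def IsCPSubnet (N : Net α) (S : Finset α) : Prop :=
  S.Nonempty ∧ S ⊆ N.nodes ∧ N.WeaklyConnectedOn S ∧ N.TransitionBordered S ∧
  N.TNetOn S ∧ ((N.nodes \ S) ∩ N.transitions).Nonempty ∧
  N.StronglyConnectedOn (N.nodes \ S)

/-- The full subnet of `N` spanned by the node set `S`, as a net. -/
def restrict (N : Net α) (S : Finset α) : Net α where
  places := N.places ∩ S
  transitions := N.transitions ∩ S
  F := fun x y => x ∈ S ∧ y ∈ S ∧ N.F x y
  disj := N.disj.mono Finset.inter_subset_left Finset.inter_subset_left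
  edges := by
    rintro x y ⟨hx, hy, hF⟩
    rcases N.edges x y hF with ⟨h1, h2⟩ | ⟨h1, h2⟩
    · exact Or.inl ⟨Finset.mem_inter.mpr ⟨h1, hx⟩, Finset.mem_inter.mpr ⟨h2, hy⟩⟩
    · exact Or.inr ⟨Finset.mem_inter.mpr ⟨h1, hx⟩, Finset.mem_inter.mpr ⟨h2, hy⟩⟩

/-- A CP-exhaustion: a family of pairwise disjoint CP-subnets whose complement
is a strongly connected T-net. -/
def IsCPExhaustion (N : Net α) {n : ℕ}
    (Nhat : Fin n → Finset α) : Prop :=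
  (∀ i, N.IsCPSubnet (Nhat i)) ∧
  (∀ i j, i ≠ j → Disjoint (Nhat i) (Nhat j)) ∧
  N.StronglyConnectedOn (N.nodes \ Finset.univ.biUnion Nhat) ∧
  N.TNetOn (N.nodes \ Finset.univ.biUnion Nhat)

/-- `t` is a way-in transition of the subnet spanned by `S`: a transition of `S`
with a pre-place outside `S`. -/
def IsWayIn (N : Net α) (S : Finset α) (t : α) : Prop :=
  t ∈ S ∧ t ∈ N.transitions ∧ ∃ p ∈ N.places, p ∉ S ∧ N.F p t

/-- A shutdown sequence for the subnet spanned by `S` (with way-in transition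
`tin`) at a marking `μ`: an occurrence sequence enabled at `μ` using only
transitions of `S` other than `tin`, after which no transition of `S` other
than (possibly) `tin` is enabled. -/
def IsShutdownSeq (N : Net α) (S : Finset α) (tin : α)
    (μ : α → ℕ) (σ : List α) (μsd : α → ℕ) : Prop :=
  N.FireSeq μ σ μsd ∧
  (∀ t ∈ σ, t ∈ S ∧ t ∈ N.transitions ∧ t ≠ tin) ∧
  (∀ t ∈ S, t ∈ N.transitions → t ≠ tin → ¬ N.Enabled μsd t)

/-- `C` spans a P-component of `N`: nonempty, strongly connected, inside `C`
every transition has exactly one pre-place and one post-place, and every place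
of `C` has all its neighbours inside `C`. -/
def IsPComponent (N : Net α) (C : Finset α) : Prop :=
  C.Nonempty ∧ C ⊆ N.nodes ∧ N.StronglyConnectedOn C ∧
  (∀ t ∈ C, t ∈ N.transitions →
    (∃! p, p ∈ C ∧ N.F p t) ∧ (∃! p, p ∈ C ∧ N.F t p)) ∧
  (∀ p ∈ C, p ∈ N.places → ∀ y, (N.F y p ∨ N.F p y) → y ∈ C)

end Net
namespace Net

section Firing

variable {α : Type*} {N : Net α}

lemma not_mem_transitions (N : Net α) {x : α} (hx : x ∈ N.places) : x ∉ N.transitions :=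
  Finset.disjoint_left.1 N.disj hx

lemma mem_places_of_F_transition {x y : α} (h : N.F x y) (hy : y ∈ N.transitions) :
    x ∈ N.places := by
  rcases N.edges x y h with h' | h'
  · exact h'.1
  · exact absurd hy (N.not_mem_transitions h'.2)

lemma mem_places_of_transition_F {x y : α} (h : N.F x y) (hx : x ∈ N.transitions) :
    y ∈ N.places := by
  rcases N.edges x y h with h' | h'
  · exact absurd hx (N.not_mem_transitions h'.1)
  · exact h'.2

lemma mem_transitions_of_place_F {x y : α} (h : N.F x y) (hx : x ∈ N.places) :
    y ∈ N.transitions := by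
  rcases N.edges x y h with h' | h'
  · exact h'.2
  · exact absurd h'.1 (N.not_mem_transitions hx)

lemma mem_transitions_of_F_place {x y : α} (h : N.F x y) (hy : y ∈ N.places) :
    x ∈ N.transitions := by
  rcases N.edges x y h with h' | h'
  · exact absurd h'.2 (N.not_mem_transitions hy)
  · exact h'.1

lemma FireSeq.append {μ ν ρ : α → ℕ} {σ τ : List α} (h : N.FireSeq μ σ ν)
    (h' : N.FireSeq ν τ ρ) : N.FireSeq μ (σ ++ τ) ρ := by
  induction h with
  | nil => exact h'
  | cons he _ ih => exact FireSeq.cons he (ih h')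

lemma Reach.trans {μ ν ρ : α → ℕ} (h : N.Reach μ ν) (h' : N.Reach ν ρ) : N.Reach μ ρ := by
  obtain ⟨σ, h⟩ := h
  obtain ⟨τ, h'⟩ := h'
  exact ⟨_, h.append h'⟩

lemma Reach.fire {μ ν : α → ℕ} {t : α} (h : N.Reach μ ν) (ht : N.Enabled ν t) :
    N.Reach μ (N.fire t ν) :=
  h.trans ⟨[t], FireSeq.cons ht (FireSeq.nil _)⟩

/-- The marking equation of an occurrence sequence. -/
lemma FireSeq.marking_eq {μ ν : α → ℕ} {σ : List α} (h : N.FireSeq μ σ ν) (p : α) :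
    ν p + σ.countP (fun t => decide (N.F p t)) = μ p + σ.countP (fun t => decide (N.F t p)) := by
  induction h with
  | nil => simp
  | @cons μ ν t σ he _ ih =>
    have h1 : N.F p t → 1 ≤ μ p := he.2 p
    simp only [List.countP_cons, decide_eq_true_eq]
    simp only [Net.fire] at ih
    split_ifs at ih ⊢ <;> grind

/-- An unmarked siphon stays unmarked. -/
lemma FireSeq.siphon_unmarked {μ ν : α → ℕ} {σ : List α} (h : N.FireSeq μ σ ν) {Q : Set α}
    (hQ : ∀ q ∈ Q, ∀ u, N.F u q → ∃ q' ∈ Q, N.F q' u) (h0 : ∀ q ∈ Q, μ q = 0) :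
    ∀ q ∈ Q, ν q = 0 := by
  induction h with
  | nil => exact h0
  | @cons μ ν t σ he _ ih =>
    refine ih fun q hq => ?_
    have h1 : ¬ N.F t q := fun hF => by
      obtain ⟨q', hq', hF'⟩ := hQ q hq t hF
      have := he.2 q' hF'
      have := h0 q' hq'
      omega
    simp [Net.fire, h1, h0 q hq]

/-- In a live Petri net, no transition has a pre-place in an unmarked siphon. -/
lemma Live.not_F_siphon {μ₀ μ : α → ℕ} (hl : N.Live μ₀) (hμ : N.Reach μ₀ μ) {Q : Set α}
    (hQ : ∀ q ∈ Q, ∀ u, N.F u q → ∃ q' ∈ Q, N.F q' u) (h0 : ∀ q ∈ Q, μ q = 0)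
    {q t : α} (hq : q ∈ Q) (ht : t ∈ N.transitions) : ¬ N.F q t := by
  intro hF
  obtain ⟨ν, ⟨σ, hσ⟩, he⟩ := hl t ht μ hμ
  have := he.2 q hF
  have := hσ.siphon_unmarked hQ h0 q hq
  omega

lemma Live.exists_enabled {μ₀ μ : α → ℕ} (hl : N.Live μ₀) (hμ : N.Reach μ₀ μ) {t : α}
    (ht : t ∈ N.transitions) : ∃ s, N.Enabled μ s := by
  obtain ⟨ν, ⟨σ, hσ⟩, he⟩ := hl t ht μ hμ
  cases hσ with
  | nil => exact ⟨t, he⟩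
  | cons he' _ => exact ⟨_, he'⟩

/-- In a bounded Petri net, a transition without pre-places has no post-places. -/
lemma Bounded.not_F_of_no_pre {μ₀ : α → ℕ} (hb : N.Bounded μ₀) {w : α}
    (hw : w ∈ N.transitions) (hpre : ∀ p, ¬ N.F p w) (q : α) : ¬ N.F w q := by
  intro hF
  obtain ⟨K, hK⟩ := hb
  have key : ∀ n : ℕ, ∃ ν, N.Reach μ₀ ν ∧ n ≤ ν q := by
    intro n
    induction n with
    | zero => exact ⟨μ₀, ⟨[], FireSeq.nil _⟩, Nat.zero_le _⟩
    | succ n ih =>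
      obtain ⟨ν, hν, hn⟩ := ih
      refine ⟨N.fire w ν, hν.fire ⟨hw, fun p hp => absurd hp (hpre p)⟩, ?_⟩
      simp [Net.fire, hF, hpre q, hn]
  obtain ⟨ν, hν, hn⟩ := key (K + 1)
  have := hK ν hν q (mem_places_of_transition_F hF hw)
  omega

/-- If every reachable marking of a bounded Petri net enables a transition satisfying `good`,
then some nonempty sequence of such transitions reproduces its marking, so that its count
is a T-invariant. -/
lemma Bounded.exists_invariant {μ₀ : α → ℕ} (hb : N.Bounded μ₀) (good : α → Prop)
    (hg : ∀ μ, N.Reach μ₀ μ → ∃ t, N.Enabled μ t ∧ good t) :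
    ∃ σ : List α, σ ≠ [] ∧ (∀ t ∈ σ, good t ∧ t ∈ N.transitions) ∧
      ∀ p ∈ N.places,
        σ.countP (fun t => decide (N.F p t)) = σ.countP (fun t => decide (N.F t p)) := by
  obtain ⟨K, hK⟩ := hb
  have : Nonempty α := ⟨(hg μ₀ ⟨[], FireSeq.nil _⟩).choose⟩
  choose! f hf hf' using hg
  let m : ℕ → α → ℕ := fun n => (fun μ => N.fire (f μ) μ)^[n] μ₀
  have hm : ∀ n, m (n + 1) = N.fire (f (m n)) (m n) := fun n =>
    Function.iterate_succ_apply' _ _ _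
  have hr : ∀ n, N.Reach μ₀ (m n) := by
    intro n
    induction n with
    | zero => exact ⟨[], FireSeq.nil _⟩
    | succ n ih => rw [hm]; exact ih.fire (hf _ ih)
  have hseq : ∀ i n, ∃ σ : List α, σ.length = n ∧ (∀ t ∈ σ, good t ∧ t ∈ N.transitions) ∧
      N.FireSeq (m i) σ (m (i + n)) := by
    intro i n
    induction n generalizing i with
    | zero => exact ⟨[], rfl, by simp, FireSeq.nil _⟩
    | succ n ih =>
      obtain ⟨σ, h1, h2, h3⟩ := ih (i + 1)
      refine ⟨f (m i) :: σ, by simp [h1], ?_, ?_⟩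
      · simp only [List.mem_cons, forall_eq_or_imp]
        exact ⟨⟨hf' _ (hr i), (hf _ (hr i)).1⟩, h2⟩
      · refine FireSeq.cons (hf _ (hr i)) ?_
        rw [← hm]
        convert h3 using 2
        omega
  let g : ℕ → (N.places → Fin (K + 1)) := fun n p =>
    ⟨m n p, Nat.lt_succ_of_le (hK _ (hr n) p p.2)⟩
  obtain ⟨i, j, hij, hgij⟩ : ∃ i j, i < j ∧ g i = g j := by
    obtain ⟨i, j, hne, h⟩ := Finite.exists_ne_map_eq_of_infinite g
    rcases lt_or_gt_of_ne hne with h' | h'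
    · exact ⟨i, j, h', h⟩
    · exact ⟨j, i, h', h.symm⟩
  obtain ⟨σ, h1, h2, h3⟩ := hseq i (j - i)
  rw [Nat.add_sub_cancel' hij.le] at h3
  refine ⟨σ, ?_, h2, fun p hp => ?_⟩
  · rintro rfl
    simp at h1
    omega
  · have h4 := h3.marking_eq p
    have h5 : m i p = m j p := congrArg Fin.val (congrFun hgij ⟨p, hp⟩)
    omega

lemma exists_neighbours {S : Finset α} (hb : N.TransitionBordered S) (hT : N.TNetOn S) {q : α}
    (hq : q ∈ S) (hq' : q ∈ N.places) :
    ∃ u w, (u ∈ S ∧ u ∈ N.transitions ∧ ∀ x, N.F x q ↔ x = u) ∧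
      (w ∈ S ∧ w ∈ N.transitions ∧ ∀ x, N.F q x ↔ x = w) := by
  obtain ⟨⟨u, ⟨hu, hu'⟩, hu''⟩, ⟨w, ⟨hw, hw'⟩, hw''⟩⟩ := hT q hq hq'
  refine ⟨u, w, ⟨hu, mem_transitions_of_F_place hu' hq', fun x => ⟨fun h => ?_, ?_⟩⟩,
    ⟨hw, mem_transitions_of_place_F hw' hq', fun x => ⟨fun h => ?_, ?_⟩⟩⟩
  · exact hu'' x ⟨hb q hq hq' x (Or.inl h), h⟩
  · rintro rfl; exact hu'
  · exact hw'' x ⟨hb q hq hq' x (Or.inr h), h⟩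
  · rintro rfl; exact hw'

/-- A function on transitions that is balanced at the places of a weakly connected
subnet is constant on its transitions. -/
lemma eq_of_weaklyConnectedOn {S : Finset α} (hw : N.WeaklyConnectedOn S) (v : α → ℕ)
    (hv : ∀ q ∈ S, q ∈ N.places → ∀ x y, (N.F x q ∨ N.F q x) → (N.F y q ∨ N.F q y) → v x = v y)
    {s t : α} (hs : s ∈ S) (hs' : s ∈ N.transitions) (ht : t ∈ S) (ht' : t ∈ N.transitions) :
    v t = v s := by
  have key : ∀ x, Relation.ReflTransGen (fun a b => a ∈ S ∧ b ∈ S ∧ (N.F a b ∨ N.F b a)) s x →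
      (x ∈ N.transitions → v x = v s) ∧
      (x ∈ N.places → ∀ y, (N.F y x ∨ N.F x y) → v y = v s) := by
    intro x hx
    induction hx with
    | refl => exact ⟨fun _ => rfl, fun h => absurd hs' (N.not_mem_transitions h)⟩
    | @tail b c _ hbc ih =>
      obtain ⟨hb, hc, hF⟩ := hbc
      refine ⟨fun h => ?_, fun h y hy => ?_⟩
      · have hbp : b ∈ N.places := by
          rcases hF with hF | hF
          · exact mem_places_of_F_transition hF h
          · exact mem_places_of_transition_F hF h
        exact ih.2 hbp c hF.symm
      · have hbt : b ∈ N.transitions := by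
          rcases hF with hF | hF
          · exact mem_transitions_of_F_place hF h
          · exact mem_transitions_of_place_F hF h
        rw [← ih.1 hbt]
        exact hv c hc h y b hy hF
  exact (key t (hw s hs t ht)).1 ht'

end Firing

section CPSubnet

variable {α : Type*} [DecidableEq α] {N : Net α} {S : Finset α}

lemma countP_eq_count_of_iff {σ : List α} {P : α → Prop} {u : α} (h : ∀ x, P x ↔ x = u) :
    σ.countP (fun x => decide (P x)) = σ.count u := by
  rw [List.count]
  refine List.countP_congr fun x _ => ?_
  simp [h x]

/-- A place outside a CP-subnet has a post-transition outside of it. -/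
lemma IsCPSubnet.exists_post_not_mem (hS : N.IsCPSubnet S) {p : α} (hp : p ∈ N.places)
    (hpS : p ∉ S) : ∃ t ∈ N.transitions, t ∉ S ∧ N.F p t := by
  obtain ⟨_, _, _, _, _, ⟨t', ht'⟩, hsc⟩ := hS
  rw [Finset.mem_inter] at ht'
  have hpn : p ∈ N.nodes \ S := by simp [Net.nodes, hp, hpS]
  rcases Relation.ReflTransGen.cases_head (hsc p hpn t' ht'.1) with h | ⟨c, hc, _⟩
  · subst h
    exact absurd ht'.2 (N.not_mem_transitions hp)
  · exact ⟨c, mem_transitions_of_place_F hc.2.2 hp, (Finset.mem_sdiff.1 hc.2.1).2, hc.2.2⟩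

/-- A way-in transition of a CP-subnet of a free-choice net has no pre-place inside. -/
lemma IsCPSubnet.not_F_wayIn (hS : N.IsCPSubnet S) (hfc : N.FreeChoice) {t : α}
    (ht : N.IsWayIn S t) {q : α} (hq : q ∈ S) : ¬ N.F q t := by
  intro hF
  obtain ⟨htS, htT, p, hp, hpS, hpt⟩ := ht
  obtain ⟨t', _, ht'S, hpt'⟩ := hS.exists_post_not_mem hp hpS
  have hq' := mem_places_of_F_transition hF htT
  have h1 := hfc p hp t hpt q hF t' hpt'
  exact ht'S (hS.2.2.2.1 q hq hq' t' (Or.inr h1))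

/-- A cluster not contained in a CP-subnet has no place in it. -/
lemma IsCPSubnet.clusterMarking_eq_zero (hS : N.IsCPSubnet S) (hfc : N.FreeChoice)
    {cl : Set α} (hcl : N.IsCluster cl) (had : ¬ cl ⊆ (S : Set α)) {q : α} (hq : q ∈ S) :
    N.clusterMarking cl q = 0 := by
  obtain ⟨x, _, rfl⟩ := hcl
  have hbord := hS.2.2.2.1
  have hin : ∀ t ∈ S, t ∈ N.transitions → ¬ N.IsWayIn S t → ∀ p, N.F p t → p ∈ S := by
    intro t ht ht' hn p hp
    by_contra hpS
    exact hn ⟨ht, ht', p, mem_places_of_F_transition hp ht', hpS, hp⟩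
  have hpl : ∀ p ∈ N.places, ¬ N.IsWayIn S p := fun p hp h => N.not_mem_transitions hp h.2.1
  let S' : Set α := {y | y ∈ S ∧ ¬ N.IsWayIn S y}
  have c1 : N.ClusterClosed S' := by
    refine ⟨fun p hp hp' t ht => ⟨hbord p hp.1 hp' t (Or.inr ht), fun hw =>
      hS.not_F_wayIn hfc hw hp.1 ht⟩, fun t ht ht' p hp => ?_⟩
    exact ⟨hin t ht.1 ht' ht.2 p hp, hpl p (mem_places_of_F_transition hp ht')⟩
  have c2 : N.ClusterClosed S'ᶜ := by
    refine ⟨fun p hp hp' t ht ht' => ?_, fun t ht ht' p hp hp' => ?_⟩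
    · exact hp ⟨hin t ht'.1 (mem_transitions_of_place_F ht hp') ht'.2 p ht, hpl p hp'⟩
    · exact ht ⟨hbord p hp'.1 (mem_places_of_F_transition hp ht') t (Or.inr hp), fun hw =>
        hS.not_F_wayIn hfc hw hp'.1 hp⟩
  have hx : x ∉ S' := fun hx => had fun y hy => (hy S' ⟨hx, c1⟩).1
  refine if_neg fun h => ?_
  exact h.1 S'ᶜ ⟨hx, c2⟩ ⟨hq, hpl q h.2⟩

/-- The transitions outside `S` from which `t` can be approached in `n` steps outside `S`. -/
def outsideLevel (N : Net α) (S : Finset α) (t : α) : ℕ → Set α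
  | 0 => {t}
  | n + 1 => {w | w ∉ S ∧ ∃ q, N.F w q ∧ ∃ x ∈ outsideLevel N S t n, N.F q x}

lemma IsCPSubnet.exists_mem_outsideLevel (hS : N.IsCPSubnet S) {t : α} (ht : N.IsWayIn S t)
    {w : α} (hw : w ∈ N.transitions) (hwS : w ∉ S) : ∃ n, w ∈ N.outsideLevel S t n := by
  obtain ⟨_, htT, p, hp, hpS, hpt⟩ := ht
  have hpath := hS.2.2.2.2.2.2 w (by simp [Net.nodes, hw, hwS]) p (by simp [Net.nodes, hp, hpS])
  have key : ∀ x, Relation.ReflTransGen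
      (fun a b => a ∈ N.nodes \ S ∧ b ∈ N.nodes \ S ∧ N.F a b) x p →
      (x ∈ N.transitions → ∃ n, x ∈ N.outsideLevel S t n) ∧
      (x ∈ N.places → ∃ n, ∃ y ∈ N.outsideLevel S t n, N.F x y) := by
    intro x hx
    induction hx using Relation.ReflTransGen.head_induction_on with
    | refl => exact ⟨fun h => absurd h (N.not_mem_transitions hp), fun _ => ⟨0, t, rfl, hpt⟩⟩
    | @head a c hac _ ih =>
      obtain ⟨ha, hc, hF⟩ := hac
      refine ⟨fun h => ?_, fun h => ?_⟩
      · obtain ⟨n, y, hy, hcy⟩ := ih.2 (mem_places_of_transition_F hF h)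
        exact ⟨n + 1, (Finset.mem_sdiff.1 ha).2, c, hF, y, hy, hcy⟩
      · obtain ⟨n, hn⟩ := ih.1 (mem_transitions_of_place_F hF h)
        exact ⟨n, c, hn, hF⟩
  exact (key w hpath).1 hw

/-- A CP-subnet of a live and bounded free-choice system has only one way-in transition. -/
lemma IsCPSubnet.wayIn_unique (hS : N.IsCPSubnet S) (hfc : N.FreeChoice) {μ₀ : α → ℕ}
    (hl : N.Live μ₀) (hb : N.Bounded μ₀) {s t : α} (hs : N.IsWayIn S s) (ht : N.IsWayIn S t) :
    s = t := by
  by_contra hst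
  let D := N.outsideLevel S t
  let good : α → Prop := fun x =>
    ∀ p y, N.F p x → N.F p y → ∀ n, y ∈ D n → ∃ m ≤ n, x ∈ D m
  have hgood : ∀ μ, N.Reach μ₀ μ → ∃ x, N.Enabled μ x ∧ good x := by
    intro μ hμ
    obtain ⟨x, hx⟩ := hl.exists_enabled hμ ht.2.1
    have hen : ∀ p y, N.F p x → N.F p y → N.Enabled μ y ∧ ∀ p', N.F p' y ↔ N.F p' x := by
      intro p y hpx hpy
      have hp := mem_places_of_F_transition hpx hx.1
      have hiff : ∀ p', N.F p' y ↔ N.F p' x := fun p' =>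
        ⟨fun h => hfc p hp y hpy p' h x hpx, fun h => hfc p hp x hpx p' h y hpy⟩
      exact ⟨⟨mem_transitions_of_place_F hpy hp, fun p' h => hx.2 p' ((hiff p').1 h)⟩, hiff⟩
    by_cases hex : ∃ n, ∃ p y, N.F p x ∧ N.F p y ∧ y ∈ D n
    · obtain ⟨p, y, hpx, hpy, hy⟩ := Nat.find_spec hex
      obtain ⟨h1, h2⟩ := hen p y hpx hpy
      refine ⟨y, h1, fun p' z hp'y hp'z n hz => ⟨_, ?_, hy⟩⟩
      exact Nat.find_min' hex ⟨p', z, (h2 p').1 hp'y, hp'z, hz⟩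
    · refine ⟨x, hx, fun p y hpx hpy n hy => ?_⟩
      exact absurd ⟨n, p, y, hpx, hpy, hy⟩ hex
  obtain ⟨σ, hσ, hσg, hinv⟩ := hb.exists_invariant good hgood
  have hsσ : s ∉ σ := by
    intro hmem
    obtain ⟨hsS, hsT, p, hp, hpS, hps⟩ := hs
    obtain ⟨y, hyT, hyS, hpy⟩ := hS.exists_post_not_mem hp hpS
    obtain ⟨n, hn⟩ := hS.exists_mem_outsideLevel ht hyT hyS
    obtain ⟨m, _, hm⟩ := (hσg s hmem).1 p y hps hpy n hn
    cases m with
    | zero => exact hst hm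
    | succ m => exact hm.1 hsS
  have hSσ : ∀ x ∈ S, x ∉ σ := by
    intro x hx hxσ
    have hc := eq_of_weaklyConnectedOn (N := N) hS.2.2.1 (fun x => σ.count x) (by
      intro q hq hq' a b ha hb'
      obtain ⟨u, w, ⟨_, _, hu⟩, ⟨_, _, hw⟩⟩ := exists_neighbours hS.2.2.2.1 hS.2.2.2.2.1 hq hq'
      have h1 := hinv q hq'
      rw [countP_eq_count_of_iff hu, countP_eq_count_of_iff hw] at h1
      simp only [hu, hw] at ha hb'
      rcases ha with rfl | rfl <;> rcases hb' with rfl | rfl <;> simp [h1])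
      hs.1 hs.2.1 hx (hσg x hxσ).2
    simp only [List.count_eq_zero_of_not_mem hsσ] at hc
    exact List.count_eq_zero.1 hc hxσ
  have hlev : ∀ n, ∀ w ∈ σ, w ∉ D n := by
    intro n
    induction n using Nat.strong_induction_on with
    | _ n ih =>
      intro w hwσ hwn
      cases n with
      | zero =>
        obtain rfl : w = t := hwn
        exact hSσ w ht.1 hwσ
      | succ n =>
        obtain ⟨_, q, hwq, x, hx, hqx⟩ := hwn
        have hq := mem_places_of_transition_F hwq (hσg w hwσ).2
        have h1 : 0 < σ.countP (fun t => decide (N.F t q)) :=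
          List.countP_pos_iff.2 ⟨w, hwσ, by simpa using hwq⟩
        rw [← hinv q hq, List.countP_pos_iff] at h1
        obtain ⟨y, hy, hqy⟩ := h1
        obtain ⟨m, hmn, hm⟩ := (hσg y hy).1 q x (by simpa using hqy) hqx n hx
        exact ih m (by omega) y hy hm
  obtain ⟨w, hw⟩ := List.exists_mem_of_ne_nil σ hσ
  obtain ⟨n, hn⟩ := hS.exists_mem_outsideLevel ht (hσg w hw).2 (fun h => hSσ w h hw)
  exact hlev n w hw hn

/-- A transition of a CP-subnet other than the way-in transition has a pre-place, and all
its pre-places lie inside the subnet. -/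
lemma IsCPSubnet.pre_of_ne_wayIn (hS : N.IsCPSubnet S) (hfc : N.FreeChoice) {μ₀ : α → ℕ}
    (hl : N.Live μ₀) (hb : N.Bounded μ₀) {s t : α} (ht : N.IsWayIn S t)
    (hs : s ∈ S) (hs' : s ∈ N.transitions) (hst : s ≠ t) :
    (∃ q, N.F q s) ∧ ∀ q, N.F q s → q ∈ S ∧ q ∈ N.places := by
  refine ⟨?_, fun q hq => ⟨?_, mem_places_of_F_transition hq hs'⟩⟩
  · by_contra! hno
    have hpost := hb.not_F_of_no_pre hs' hno
    rcases Relation.ReflTransGen.cases_head (hS.2.2.1 s hs t ht.1) with h | ⟨c, hc, _⟩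
    · exact hst h
    · rcases hc.2.2 with h | h
      · exact hpost c h
      · exact hno c h
  · by_contra hqS
    exact hst (hS.wayIn_unique hfc hl hb
      ⟨hs, hs', q, mem_places_of_F_transition hq hs', hqS, hq⟩ ht)

/-- Realizability of firing counts inside a CP-subnet: a count `v` that avoids the way-in
transition and is compatible with the marking on the subnet can be fired there, hence
any `t` with `v t > 0` can be enabled. -/
lemma IsCPSubnet.exists_enabling (hS : N.IsCPSubnet S) (hfc : N.FreeChoice) {μ₀ : α → ℕ}
    (hl : N.Live μ₀) (hb : N.Bounded μ₀) {tin t : α} (htin : N.IsWayIn S tin)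
    (ht : t ∈ S) (ht' : t ∈ N.transitions) (k : ℕ) :
    ∀ (v μ μ' : α → ℕ), (∑ x ∈ S, v x) = k → N.Reach μ₀ μ → (∀ p ∈ S, μ' p = μ p) →
      v tin = 0 → 0 < v t →
      (∀ q ∈ S, q ∈ N.places → ∀ u w, N.F u q → N.F q w → v w ≤ μ q + v u) →
      ∃ (σ : List α) (ν : α → ℕ),
        (N.restrict S).FireSeq μ' σ ν ∧ tin ∉ σ ∧ (N.restrict S).Enabled ν t := by
  induction k with
  | zero =>
    intro v μ μ' hk _ _ _ hvt _
    have := (Finset.sum_eq_zero_iff.1 hk) t ht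
    omega
  | succ k ih =>
    intro v μ μ' hk hμ hμ' hvin hvt hv
    have hpre : ∀ w ∈ S, w ∈ N.transitions → 0 < v w →
        ∀ q, N.F q w → q ∈ S ∧ q ∈ N.places := fun w hw hw' hpos =>
      (hS.pre_of_ne_wayIn hfc hl hb htin hw hw' (by rintro rfl; omega)).2
    obtain ⟨w, hwS, hwpos, hwe⟩ : ∃ w ∈ S, 0 < v w ∧ N.Enabled μ w := by
      by_contra! hno
      let Q : Set α := {q | μ q = 0 ∧ ∃ w ∈ S, w ∈ N.transitions ∧ 0 < v w ∧ N.F q w}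
      have hQ' : ∀ w ∈ S, w ∈ N.transitions → 0 < v w → ∃ q ∈ Q, N.F q w := by
        intro w hw hw' hpos
        have h1 := hno w hw hpos
        simp only [Enabled, hw', true_and, not_forall] at h1
        obtain ⟨q, hq, h0⟩ := h1
        exact ⟨q, ⟨by omega, w, hw, hw', hpos, hq⟩, hq⟩
      have hQ : ∀ q ∈ Q, ∀ u, N.F u q → ∃ q' ∈ Q, N.F q' u := by
        rintro q ⟨h0, w, hw, hw', hpos, hqw⟩ u hu
        obtain ⟨hqS, hqP⟩ := hpre w hw hw' hpos q hqw
        have h1 := hv q hqS hqP u w hu hqw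
        exact hQ' u (hS.2.2.2.1 q hqS hqP u (Or.inl hu)) (mem_transitions_of_F_place hu hqP)
          (by omega)
      obtain ⟨q, hq, hqt⟩ := hQ' t ht ht' hvt
      exact hl.not_F_siphon hμ hQ (fun q hq => hq.1) hq ht' hqt
    have hwe' : (N.restrict S).Enabled μ' w :=
      ⟨Finset.mem_inter.2 ⟨hwe.1, hwS⟩, fun p hp => by
        rw [hμ' p hp.1]; exact hwe.2 p hp.2.2⟩
    by_cases hwt : w = t
    · subst hwt
      exact ⟨[], μ', FireSeq.nil _, by simp, hwe'⟩
    · obtain ⟨σ, ν, h1, h2, h3⟩ := ih (Function.update v w (v w - 1)) (N.fire w μ)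
        ((N.restrict S).fire w μ') (by
          rw [Finset.sum_update_of_mem hwS]
          rw [← Finset.add_sum_erase S v hwS, Finset.erase_eq] at hk
          omega)
        (hμ.fire hwe)
        (fun p hp => by simp [Net.fire, Net.restrict, hp, hwS, hμ' p hp])
        (by rw [Function.update_of_ne (by rintro rfl; omega)]; exact hvin)
        (by rw [Function.update_of_ne (Ne.symm hwt)]; exact hvt)
        (by
          intro q hq hq' a b ha hb'
          obtain ⟨u, z, ⟨_, _, hu⟩, ⟨_, _, hz⟩⟩ :=
            exists_neighbours hS.2.2.2.1 hS.2.2.2.2.1 hq hq'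
          have h1 := hv q hq hq' a b ha hb'
          have h2 := hwe.2 q
          obtain rfl := (hu a).1 ha
          obtain rfl := (hz b).1 hb'
          simp only [Net.fire, hu, hz, Function.update_apply] at h2 ⊢
          grind)
      refine ⟨w :: σ, ν, FireSeq.cons hwe' h1, ?_, h3⟩
      simp only [List.mem_cons, not_or]
      exact ⟨by rintro rfl; omega, h2⟩

end CPSubnet

end Net

/-- **Internal enabling in adapted CP-subnets.** Let `(N, μ₀)` be a perpetual
free-choice system with regeneration cluster `cl`, let `S` span a `cl`-adapted
CP-subnet with way-in transition `tin`, let `μ` be a reachable marking and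
`μ̂` its restriction to the subnet. Then every transition `t` of the subnet
reachable by a path inside the subnet from a place `p` with `μ̂ p = 1` can be
enabled by firing an occurrence sequence `σ` of `(N̂, μ̂)` with `tin ∉ σ`. -/
theorem adapted_cpSubnet_internal_enabling
    {α : Type*} [DecidableEq α] (N : Net α) (μ₀ : α → ℕ) (cl : Set α)
    (hfc : N.FreeChoice) (hperp : N.Perpetual μ₀ cl)
    (S : Finset α) (hS : N.IsCPSubnet S) (had : ¬ cl ⊆ (S : Set α))
    (tin : α) (htin : N.IsWayIn S tin)
    (μ : α → ℕ) (hμ : N.Reach μ₀ μ)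
    (t : α) (ht : t ∈ S) (ht' : t ∈ N.transitions)
    (hpath : ∃ (p : α) (δ : List α), p ∈ S ∧ p ∈ N.places ∧ μ p = 1 ∧
      N.IsPath δ ∧ (∀ x ∈ δ, x ∈ S) ∧ δ.head? = some p ∧ δ.getLast? = some t) :
    ∃ (σ : List α) (ν : α → ℕ),
      (N.restrict S).FireSeq μ σ ν ∧ tin ∉ σ ∧ (N.restrict S).Enabled ν t := by
  obtain ⟨hl, hb, hcl, hhome⟩ := hperp
  obtain ⟨ν, ⟨σ, hσ⟩, hν⟩ := hhome μ hμ
  have hbord := hS.2.2.2.1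
  have hν0 : ∀ q ∈ S, q ∈ N.places → ν q = 0 := fun q hq hq' => by
    rw [hν q hq', hS.clusterMarking_eq_zero hfc hcl had hq]
  have hbal : ∀ q ∈ S, q ∈ N.places → ∀ u w, N.F u q → N.F q w →
      σ.count w = μ q + σ.count u := by
    intro q hq hq' a b ha hb'
    obtain ⟨u, w, ⟨_, _, hu⟩, ⟨_, _, hw⟩⟩ := Net.exists_neighbours hbord hS.2.2.2.2.1 hq hq'
    have h1 := hσ.marking_eq q
    rw [Net.countP_eq_count_of_iff hu, Net.countP_eq_count_of_iff hw, hν0 q hq hq'] at h1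
    obtain rfl := (hu a).1 ha
    obtain rfl := (hw b).1 hb'
    omega
  have hmin : ∀ w ∈ S, w ∈ N.transitions → σ.count tin ≤ σ.count w := by
    intro w hwS hwT
    by_contra! hlt
    let Q : Set α := {q | ∃ w ∈ S, w ∈ N.transitions ∧ σ.count w < σ.count tin ∧ N.F q w}
    have hpre : ∀ w ∈ S, w ∈ N.transitions → σ.count w < σ.count tin →
        (∃ q, N.F q w) ∧ ∀ q, N.F q w → q ∈ S ∧ q ∈ N.places := fun w hw hw' h =>
      hS.pre_of_ne_wayIn hfc hl hb htin hw hw' (by rintro rfl; omega)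
    have hQ : ∀ q ∈ Q, ∀ u, N.F u q → ∃ q' ∈ Q, N.F q' u := by
      rintro q ⟨w, hw, hw', hlt, hqw⟩ u hu
      obtain ⟨hqS, hqP⟩ := (hpre w hw hw' hlt).2 q hqw
      have h1 := hbal q hqS hqP u w hu hqw
      have huS := hbord q hqS hqP u (Or.inl hu)
      have huT := Net.mem_transitions_of_F_place hu hqP
      have hult : σ.count u < σ.count tin := by omega
      obtain ⟨q', hq'⟩ := (hpre u huS huT hult).1
      exact ⟨q', ⟨u, huS, huT, hult, hq'⟩, hq'⟩
    obtain ⟨q, hq⟩ := (hpre w hwS hwT hlt).1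
    refine hl.not_F_siphon (hμ.trans ⟨σ, hσ⟩) hQ ?_ ⟨w, hwS, hwT, hlt, hq⟩ hwT hq
    rintro q ⟨w, hw, hw', hlt, hqw⟩
    obtain ⟨hqS, hqP⟩ := (hpre w hw hw' hlt).2 q hqw
    exact hν0 q hqS hqP
  have htcount : σ.count tin < σ.count t := by
    obtain ⟨p, δ, hpS, hpP, hp1, ⟨_, _, hchain⟩, hδS, hhead, hlast⟩ := hpath
    let P : α → Prop := fun x => (x ∈ N.transitions → σ.count tin < σ.count x) ∧
      (x ∈ N.places → ∀ w, N.F x w → σ.count tin < σ.count w)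
    have hp : P p := by
      refine ⟨fun h => absurd h (N.not_mem_transitions hpP), fun _ w hw => ?_⟩
      obtain ⟨u, _, ⟨huS, huT, hu⟩, _⟩ := Net.exists_neighbours hbord hS.2.2.2.2.1 hpS hpP
      have h1 := hbal p hpS hpP u w ((hu u).2 rfl) hw
      have h2 := hmin u huS huT
      omega
    have hstep : ∀ x y, y ∈ S → N.F x y → P x → P y := by
      intro x y hy hF hx
      refine ⟨fun h => hx.2 (Net.mem_places_of_F_transition hF h) y hF, fun h w hw => ?_⟩
      have h1 := hx.1 (Net.mem_transitions_of_F_place hF h)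
      have h2 := hbal y hy h x w hF hw
      omega
    have key : ∀ (l : List α) (a b : α), (∀ x ∈ l, x ∈ S) → List.IsChain N.F l →
        l.head? = some a → l.getLast? = some b → P a → P b := by
      intro l
      induction l with
      | nil => intro a b _ _ h; simp at h
      | cons c l ih =>
        intro a b hlS hc ha hb' hPa
        cases l with
        | nil => simp at ha hb'; subst ha; subst hb'; exact hPa
        | cons d l =>
          rw [List.isChain_cons_cons] at hc
          simp only [List.head?_cons, Option.some.injEq] at ha
          subst ha
          refine ih d b (fun x hx => hlS x (List.mem_cons_of_mem _ hx)) hc.2 rfl ?_ ?_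
          · rwa [List.getLast?_cons_cons] at hb'
          · exact hstep c d (hlS d (by simp)) hc.1 hPa
    exact (key δ p t hδS hchain hhead hlast hp).1 ht'
  refine hS.exists_enabling hfc hl hb htin ht ht' _ (fun x => σ.count x - σ.count tin) μ μ rfl hμ
    (fun _ _ => rfl) (Nat.sub_self _) (Nat.sub_pos_of_lt htcount) fun q hq hq' u w hu hw => ?_
  have h1 := hbal q hq hq' u w hu hw
  omega
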